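/- arXiv:2101.07656 — 2 statements merged into one kernel-verified Lean document; each statement's English description precedes it below -/
import Mathlib

section
/- Let X be a uniform space whose uniformity is induced by a metric (i.e., X is a metrizable uniform space). If X is weakly chained, then X is locally uniformly joinable. -/
/-! Basic definitions: chains, `E`-homotopy, generalized paths, and the
joinability properties of uniform spaces, following Brodskiy–Dydak–LaBuz–Mitra
and Plaut. -/

/-- A subset `A` of `X` is `E`-bounded if `A × A ⊆ E`. -/
def IsEBounded {X : Type*} (E : Set (X × X)) (A : Set X) : Prop :=
  ∀ a ∈ A, ∀ b ∈ A, (a, b) ∈ E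

/-- A list of points is an `E`-chain if every pair of consecutive points
belongs to `E`. -/
def IsEChain {X : Type*} (E : Set (X × X)) (c : List X) : Prop :=
  c.Chain' fun a b => (a, b) ∈ E

/-- `c` is an `E`-chain from `x` to `y`. -/
def IsEChainFromTo {X : Type*} (E : Set (X × X)) (c : List X) (x y : X) : Prop :=
  IsEChain E c ∧ c.head? = some x ∧ c.getLast? = some y

/-- A basic move inserts a single point `z` between two consecutive points
`a`, `b` of a chain, in such a way that `{a, z, b}` is `E`-bounded. -/
def BasicMove {X : Type*} (E : Set (X × X)) (c d : List X) : Prop :=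
  ∃ (p q : List X) (a z b : X),
    IsEBounded E {a, z, b} ∧ c = p ++ a :: b :: q ∧ d = p ++ a :: z :: b :: q

/-- Two `E`-chains are `E`-homotopic if one can be obtained from the other by a
finite sequence of basic moves (insertions or deletions); endpoints are kept
fixed automatically. -/
def EHomotopic {X : Type*} (E : Set (X × X)) : List X → List X → Prop :=
  Relation.EqvGen (BasicMove E)

/-- A generalized path from `x` to `y` in a uniform space `X`: a compatible
family of (`E`-homotopy classes of) `E`-chains from `x` to `y`, indexed by the
entourages `E` of `X`.  It is recorded by a choice of representative chain for
each entourage, such that for `F ⊆ E` the representative at `F` is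
`E`-homotopic to the representative at `E` (this determines, and is determined
by, the family of homotopy classes). -/
structure GenPath {X : Type*} [UniformSpace X] (x y : X) where
  /-- a representative `E`-chain for each entourage `E` -/
  chain : ∀ E : Set (X × X), E ∈ uniformity X → List X
  isChain : ∀ (E : Set (X × X)) (hE : E ∈ uniformity X),
    IsEChainFromTo E (chain E hE) x y
  compat : ∀ (F E : Set (X × X)) (hF : F ∈ uniformity X) (hE : E ∈ uniformity X),
    F ⊆ E → EHomotopic E (chain F hF) (chain E hE)

/-- A generalized path from `x` to `y` is `E`-short if its `E`-level homotopy
class is the class of the two-point chain `x, y`. -/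
def GenPath.EShort {X : Type*} [UniformSpace X] {x y : X} (α : GenPath x y)
    (E : Set (X × X)) : Prop :=
  ∀ hE : E ∈ uniformity X, EHomotopic E (α.chain E hE) [x, y]

/-- `X` is chain connected if for every entourage `E`, every pair of points of
`X` can be joined by an `E`-chain. -/
def ChainConnected (X : Type*) [UniformSpace X] : Prop :=
  ∀ E ∈ uniformity X, ∀ x y : X, ∃ c : List X, IsEChainFromTo E c x y

/-- `X` is uniformly joinable if every pair of points can be joined by a
generalized path. -/
def UniformlyJoinable (X : Type*) [UniformSpace X] : Prop :=
  ∀ x y : X, Nonempty (GenPath x y)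

/-- `X` is locally uniformly joinable if for every entourage `E` there is an
entourage `F` such that any pair `(x, y) ∈ F` can be joined by an `E`-short
generalized path. -/
def LocallyUniformlyJoinable (X : Type*) [UniformSpace X] : Prop :=
  ∀ E ∈ uniformity X, ∃ F ∈ uniformity X, ∀ x y : X, (x, y) ∈ F →
    ∃ α : GenPath x y, α.EShort E

/-- `X` is weakly chained if it is chain connected and for every entourage `E`
there is an entourage `F ⊆ E` such that every pair `(x, y) ∈ F` can be joined
by arbitrarily fine chains that are `E`-short (i.e. for every entourage `G`
there is a `G`-chain from `x` to `y` that is `E`-homotopic to the two-point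
chain `x, y`). -/
def WeaklyChained (X : Type*) [UniformSpace X] : Prop :=
  ChainConnected X ∧
    ∀ E ∈ uniformity X, ∃ F ∈ uniformity X, F ⊆ E ∧
      ∀ x y : X, (x, y) ∈ F → ∀ G ∈ uniformity X,
        ∃ c : List X, IsEChainFromTo G c x y ∧ EHomotopic E c [x, y]

theorem EHomotopic.mono {X : Type*} {E F : Set (X × X)} (hEF : E ⊆ F) {c d : List X}
    (h : EHomotopic E c d) : EHomotopic F c d := by
  refine Relation.EqvGen.mono ?_ _ _ h
  rintro c d ⟨p, q, a, z, b, hb, hc, hd⟩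
  exact ⟨p, q, a, z, b, fun u hu v hv => hEF (hb u hu v hv), hc, hd⟩

/-- `E`-homotopy is preserved by adding points at both ends. -/
theorem EHomotopic.append {X : Type*} {E : Set (X × X)} (s t : List X) {c d : List X}
    (h : EHomotopic E c d) : EHomotopic E (s ++ c ++ t) (s ++ d ++ t) := by
  induction h with
  | rel c d h =>
    obtain ⟨p, q, a, z, b, hb, rfl, rfl⟩ := h
    exact .rel _ _ ⟨s ++ p, q ++ t, a, z, b, hb, by simp, by simp⟩
  | refl => exact .refl _
  | symm _ _ _ ih => exact .symm _ _ ih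
  | trans _ _ _ _ _ ih₁ ih₂ => exact .trans _ _ _ ih₁ ih₂

/-- If every `F`-close pair is joined by an `E`-short `G`-chain, then every `F`-chain is
`E`-homotopic to a `G`-chain with the same endpoints. -/
theorem IsEChainFromTo.exists_refinement {X : Type*} {E F G : Set (X × X)}
    (hFG : ∀ x y : X, (x, y) ∈ F →
      ∃ c : List X, IsEChainFromTo G c x y ∧ EHomotopic E c [x, y])
    {c : List X} {x y : X} (hc : IsEChainFromTo F c x y) :
    ∃ d : List X, IsEChainFromTo G d x y ∧ EHomotopic E d c := by
  induction c generalizing x with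
  | nil => simp [IsEChainFromTo] at hc
  | cons a c ih =>
    cases c with
    | nil =>
      obtain ⟨-, hx, hy⟩ := hc
      exact ⟨[a], ⟨List.isChain_singleton a, hx, hy⟩, .refl _⟩
    | cons b q =>
      obtain ⟨hchain, hx, hy⟩ := hc
      obtain rfl : a = x := by simpa using hx
      obtain ⟨hab, hq⟩ := List.isChain_cons_cons.1 hchain
      obtain ⟨d, ⟨hd, hdb, hdy⟩, hdq⟩ := ih (x := b) ⟨hq, rfl, by simpa using hy⟩
      obtain ⟨e, ⟨he, hea, heb⟩, hes⟩ := hFG a b hab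
      obtain ⟨d, rfl⟩ := List.head?_eq_some_iff.1 hdb
      obtain ⟨e, rfl⟩ := List.getLast?_eq_some_iff.1 heb
      refine ⟨e ++ b :: d, ⟨List.isChain_split.2 ⟨he, hd⟩, ?_, ?_⟩, ?_⟩
      · cases e <;> simpa using hea
      · simpa [List.getLast?_append] using hdy
      · have h₁ := hes.append [] d
        have h₂ := hdq.append [a] []
        simp only [List.nil_append, List.append_assoc, List.append_nil,
          List.cons_append] at h₁ h₂
        exact .trans _ _ _ h₁ h₂

theorem IsEChainFromTo.mono {X : Type*} {E F : Set (X × X)} (hEF : E ⊆ F) {c : List X}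
    {x y : X} (h : IsEChainFromTo E c x y) : IsEChainFromTo F c x y :=
  ⟨List.IsChain.imp (fun _ _ hab => hEF hab) h.1, h.2⟩

/-- A weakly chained metrizable uniform space is locally uniformly joinable. -/
theorem weaklyChained_implies_locallyUniformlyJoinable {X : Type*} [MetricSpace X]
    (h : WeaklyChained X) : LocallyUniformlyJoinable X := by
  obtain ⟨-, h⟩ := h
  choose! f hf hfE hfc using h
  intro E hE
  obtain ⟨B, hB⟩ := (uniformity X).exists_antitone_basis
  let e : ℕ → Set (X × X) := fun n => Nat.rec E (fun n D => f D ∩ B n) n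
  have he : ∀ n, e n ∈ uniformity X := by
    intro n
    induction n with
    | zero => exact hE
    | succ n ih => exact Filter.inter_mem (hf _ ih) (hB.mem n)
  have hanti : Antitone e :=
    antitone_nat_of_succ_le fun n => Set.inter_subset_left.trans (hfE _ (he n))
  have hsmall : ∀ G ∈ uniformity X, ∃ n, e n ⊆ G := fun G hG => by
    obtain ⟨n, hn⟩ := hB.mem_iff.1 hG
    exact ⟨n + 1, Set.inter_subset_right.trans hn⟩
  choose! N hN using hsmall
  refine ⟨f E, hf E hE, fun x y hxy => ?_⟩
  have step : ∀ n (c : List X), IsEChainFromTo (f (e n)) c x y →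
      ∃ d : List X, IsEChainFromTo (f (e (n + 1))) d x y ∧ EHomotopic (e n) d c :=
    fun n c hc => hc.exists_refinement fun a b hab =>
      hfc (e n) (he n) a b hab _ (hf _ (he (n + 1)))
  choose! g hg hgc using step
  let c : ℕ → List X := fun n => Nat.rec [x, y] g n
  have hc : ∀ n, IsEChainFromTo (f (e n)) (c n) x y := by
    intro n
    induction n with
    | zero => exact ⟨List.isChain_pair.2 hxy, rfl, rfl⟩
    | succ n ih => exact hg n _ ih
  have hcc : ∀ n m, n ≤ m → EHomotopic (e n) (c m) (c n) := by
    intro n m hnm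
    induction m, hnm using Nat.le_induction with
    | base => exact .refl _
    | succ m hnm ih => exact .trans _ _ _ ((hgc m _ (hc m)).mono (hanti hnm)) ih
  have hcG : ∀ (G : Set (X × X)) (m n : ℕ), e m ⊆ G → e n ⊆ G →
      EHomotopic G (c m) (c n) := fun G m n hm hn =>
    .trans _ _ _ (.symm _ _ ((hcc m (max m n) (le_max_left _ _)).mono hm))
      ((hcc n (max m n) (le_max_right _ _)).mono hn)
  exact ⟨{ chain := fun G _ => c (N G)
           isChain := fun G hG => (hc (N G)).mono ((hfE _ (he _)).trans (hN G hG))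
           compat := fun F G hF hG hFG => hcG G _ _ ((hN F hF).trans hFG) (hN G hG) },
    fun hE => hcG E (N E) 0 (hN E hE) subset_rfl⟩
end

section
/- Every path connected uniform space is uniformly joinable: if X is a uniform space and any two points of X can be joined by a continuous path, then any two points of X can be joined by a generalized path. -/
namespace EHomotopic

variable {X : Type*} {E : Set (X × X)}

theorem refl (c : List X) : EHomotopic E c c := Relation.EqvGen.refl c

theorem symm {c d : List X} (h : EHomotopic E c d) : EHomotopic E d c :=
  Relation.EqvGen.symm _ _ h

theorem trans {c d e : List X} (h : EHomotopic E c d) (h' : EHomotopic E d e) :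
    EHomotopic E c e :=
  Relation.EqvGen.trans _ _ _ h h'

theorem append_right {c d : List X} (h : EHomotopic E c d) (q : List X) :
    EHomotopic E (c ++ q) (d ++ q) := by
  induction h with
  | rel c d h =>
    obtain ⟨p, r, a, z, b, hb, rfl, rfl⟩ := h
    exact Relation.EqvGen.rel _ _ ⟨p, r ++ q, a, z, b, hb, by simp, by simp⟩
  | refl c => exact refl _
  | symm c d _ ih => exact ih.symm
  | trans c d e _ _ ih₁ ih₂ => exact ih₁.trans ih₂

/-- A list of points may be inserted between two consecutive points of a chain, provided all the
points involved form an `E`-bounded set. -/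
theorem insert_list {A : Set X} (hA : IsEBounded E A) {b : X} (hb : b ∈ A) (q l : List X)
    (hl : ∀ z ∈ l, z ∈ A) (p : List X) {a : X} (ha : a ∈ A) :
    EHomotopic E (p ++ a :: b :: q) (p ++ a :: (l ++ b :: q)) := by
  induction l generalizing p a with
  | nil => exact refl _
  | cons z l ih =>
    have hz : z ∈ A := hl z (by simp)
    have hsub : ({a, z, b} : Set X) ⊆ A := by
      rintro w (rfl | rfl | rfl) <;> assumption
    have hmove : EHomotopic E (p ++ a :: b :: q) (p ++ a :: z :: b :: q) :=
      Relation.EqvGen.rel _ _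
        ⟨p, q, a, z, b, fun u hu v hv => hA u (hsub hu) v (hsub hv), rfl, rfl⟩
    have htail := ih (fun w hw => hl w (by simp [hw])) (p ++ [a]) hz
    exact hmove.trans (by simpa using htail)

/-- A sequence of points sampled at the multiples of `k` is `E`-homotopic to the full sequence,
provided terms at distance at most `k` are `E`-close. -/
theorem sample {g : ℕ → X} {k : ℕ} (hk : 0 < k)
    (hg : ∀ i j, i ≤ j + k → j ≤ i + k → (g i, g j) ∈ E) (n : ℕ) :
    EHomotopic E ((List.range (n + 1)).map fun i => g (i * k))
      ((List.range (n * k + 1)).map g) := by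
  induction n with
  | zero => simpa using refl _
  | succ n ih =>
    obtain ⟨m, rfl⟩ : ∃ m, k = m + 1 := ⟨k - 1, by omega⟩
    rw [List.range_succ, List.map_append]
    refine (ih.append_right _).trans ?_
    have hbounded : IsEBounded E (g '' Set.Icc (n * (m + 1)) (n * (m + 1) + (m + 1))) := by
      rintro _ ⟨i, hi, rfl⟩ _ ⟨j, hj, rfl⟩
      rw [Set.mem_Icc] at hi hj
      exact hg i j (by omega) (by omega)
    have hinsert := insert_list hbounded
      (Set.mem_image_of_mem g (Set.right_mem_Icc.2 (Nat.le_add_right _ _))) []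
      ((List.range m).map fun i => g (n * (m + 1) + 1 + i))
      (by
        simp only [List.mem_map, List.mem_range]
        rintro _ ⟨i, hi, rfl⟩
        exact ⟨_, ⟨by omega, by omega⟩, rfl⟩)
      ((List.range (n * (m + 1))).map g)
      (Set.mem_image_of_mem g (Set.left_mem_Icc.2 (Nat.le_add_right _ _)))
    have hsplit : (n + 1) * (m + 1) + 1 = (n * (m + 1) + 1 + m) + 1 := by ring
    rw [hsplit, List.range_succ (n := n * (m + 1) + 1 + m),
      List.range_add (n := n * (m + 1) + 1),
      List.range_succ (n := n * (m + 1))]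
    have hlast : (n + 1) * (m + 1) = n * (m + 1) + (m + 1) := by ring
    have hlast' : n * (m + 1) + 1 + m = n * (m + 1) + (m + 1) := by ring
    simpa [hlast, hlast', Function.comp_def] using hinsert

end EHomotopic

/-- The points `f 0, f (1 / n), …, f 1`. -/
noncomputable def gridChain {X : Type*} (f : ℝ → X) (n : ℕ) : List X :=
  (List.range (n + 1)).map fun i : ℕ => f (i / n)

/-- The mesh `1 / n` is `E`-fine for `f` if `f` sends points at distance at most `1 / n` to
`E`-close points. -/
def IsFineMesh {X : Type*} (E : Set (X × X)) (f : ℝ → X) (n : ℕ) : Prop :=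
  0 < n ∧ ∀ s t : ℝ, |s - t| ≤ 1 / n → (f s, f t) ∈ E

namespace IsFineMesh

variable {X : Type*} {E : Set (X × X)} {f : ℝ → X} {n m : ℕ}

theorem isEChainFromTo (h : IsFineMesh E f n) : IsEChainFromTo E (gridChain f n) (f 0) (f 1) := by
  have hn : (n : ℝ) ≠ 0 := by exact_mod_cast h.1.ne'
  refine ⟨?_, ?_, ?_⟩
  · refine (List.isChain_map _).2 ((List.isChain_range _ _).2 fun i _ => h.2 _ _ ?_)
    rw [← sub_div, abs_div, Nat.abs_cast]
    simp
  · simp [gridChain, List.range_succ_eq_map]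
  · simp [gridChain, List.range_succ, hn]

theorem eHomotopic_mul (h : IsFineMesh E f n) (hm : 0 < m) :
    EHomotopic E (gridChain f n) (gridChain f (n * m)) := by
  have hn' : (0 : ℝ) < n := by exact_mod_cast h.1
  have hm' : (0 : ℝ) < m := by exact_mod_cast hm
  have key := EHomotopic.sample (E := E) (g := fun i : ℕ => f (i / (n * m : ℕ))) hm
    (fun i j hij hji => h.2 _ _ (by
      have hij' : (i : ℝ) ≤ j + m := by exact_mod_cast hij
      have hji' : (j : ℝ) ≤ i + m := by exact_mod_cast hji
      rw [← sub_div, abs_div, Nat.abs_cast, Nat.cast_mul, div_le_div_iff₀ (by positivity) hn']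
      have : |(i : ℝ) - j| ≤ m := abs_le.2 ⟨by linarith, by linarith⟩
      nlinarith)) n
  have hcoarse : gridChain f n =
      (List.range (n + 1)).map fun i => f ((i * m : ℕ) / (n * m : ℕ)) := by
    refine List.map_congr_left fun i _ => congrArg f ?_
    push_cast
    rw [mul_div_mul_right _ _ hm'.ne']
  rw [hcoarse]
  exact key

theorem eHomotopic (hn : IsFineMesh E f n) (hm : IsFineMesh E f m) :
    EHomotopic E (gridChain f n) (gridChain f m) :=
  (hn.eHomotopic_mul hm.1).trans (mul_comm n m ▸ (hm.eHomotopic_mul hn.1).symm)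

end IsFineMesh

theorem UniformContinuous.exists_isFineMesh {X : Type*} [UniformSpace X] {f : ℝ → X}
    (hf : UniformContinuous f) {E : Set (X × X)} (hE : E ∈ uniformity X) :
    ∃ n, IsFineMesh E f n := by
  obtain ⟨δ, hδ, hδE⟩ := Metric.mem_uniformity_dist.1 (hf hE)
  obtain ⟨n, hn⟩ := exists_nat_one_div_lt hδ
  refine ⟨n + 1, n.succ_pos, fun s t hst => hδE (lt_of_le_of_lt ?_ hn)⟩
  rw [Real.dist_eq]
  exact_mod_cast hst

/-- Sampling a uniformly continuous map on finer and finer grids of the unit interval gives a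
generalized path. -/
noncomputable def GenPath.ofUniformContinuous {X : Type*} [UniformSpace X] {f : ℝ → X}
    (hf : UniformContinuous f) : GenPath (f 0) (f 1) where
  chain _ hE := gridChain f (hf.exists_isFineMesh hE).choose
  isChain _ hE := (hf.exists_isFineMesh hE).choose_spec.isEChainFromTo
  compat _ _ hF hE hFE :=
    IsFineMesh.eHomotopic
      ⟨(hf.exists_isFineMesh hF).choose_spec.1,
        fun s t hst => hFE ((hf.exists_isFineMesh hF).choose_spec.2 s t hst)⟩
      (hf.exists_isFineMesh hE).choose_spec

/-- Every path connected uniform space is uniformly joinable: if any two points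
of `X` can be joined by a continuous path, then any two points of `X` can be
joined by a generalized path. -/
theorem pathConnected_implies_uniformlyJoinable {X : Type*} [UniformSpace X]
    (h : ∀ x y : X, Joined x y) : UniformlyJoinable X := by
  intro x y
  obtain ⟨γ⟩ := h x y
  have α := GenPath.ofUniformContinuous γ.uniformContinuous_extend
  rw [γ.extend_zero, γ.extend_one] at α
  exact ⟨α⟩
end
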